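/- For every integer n ≥ 3, the word η_n = 3 5 7 ⋯ (2n−3) (2n) (2n) 2 4 6 ⋯ (2n−2) (2n−1) 1 (consisting of the odd numbers 3, 5, …, 2n−3 in increasing order, followed by two copies of 2n, followed by the even numbers 2, 4, …, 2n−2 in increasing order, followed by 2n−1, followed by 1) has length 2n+1 and satisfies ⟨η_n⟩_fast = 2n − 2 and ⟨η_n⟩_slow = n. -/

import Mathlib

lemma foldr_max_mem {w : List ℕ} (h : w ≠ []) : w.foldr max 0 ∈ w := by
  induction w with
  | nil => exact absurd rfl h
  | cons a l ih =>
    rcases eq_or_ne l [] with rfl | hl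
    · simp
    · have hm := ih hl
      simp only [List.foldr_cons]
      rcases max_choice a (l.foldr max 0) with h' | h' <;> rw [h']
      · exact List.mem_cons_self
      · exact List.mem_cons_of_mem _ hm

lemma headI_mem {α : Type*} [Inhabited α] {l : List α} (h : l ≠ []) : l.headI ∈ l := by
  cases l with
  | nil => exact absurd rfl h
  | cons a t => simp

/-- `blocks n w` is the list of maximal (possibly empty) blocks of `w`
separated by occurrences of the letter `n`; that is, if `n` occurs `k` times
in `w`, then `blocks n w = [A₁, A₂, …, A_{k+1}]` where `w = A₁ n A₂ n ⋯ n A_{k+1}`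
and no `Aᵢ` contains the letter `n`. -/
def blocks (n : ℕ) : List ℕ → List (List ℕ)
  | [] => [[]]
  | a :: l =>
    if a = n then [] :: blocks n l
    else (a :: (blocks n l).headI) :: (blocks n l).tail

lemma blocks_ne_nil (n : ℕ) (w : List ℕ) : blocks n w ≠ [] := by
  cases w with
  | nil => simp [blocks]
  | cons a l =>
    simp only [blocks]
    split <;> simp

lemma blocks_length {n : ℕ} {w : List ℕ} : ∀ {A : List ℕ}, A ∈ blocks n w →
    A.length + w.count n ≤ w.length := by
  induction w with
  | nil =>
    intro A hA
    simp only [blocks, List.mem_singleton] at hA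
    subst hA; simp
  | cons a l ih =>
    intro A hA
    by_cases h : a = n
    · subst h
      simp only [blocks, if_pos rfl] at hA
      have hcc : (a :: l).count a = l.count a + 1 := by simp
      cases hA with
      | head =>
        have := List.count_le_length (a := a) (l := l)
        simp only [List.length_nil, List.length_cons, hcc]
        omega
      | tail _ h1 =>
        have := ih h1
        simp only [List.length_cons, hcc]
        omega
    · simp only [blocks, if_neg h] at hA
      have hcc : (a :: l).count n = l.count n := by
        simp [List.count_cons, h]
      cases hA with
      | head =>
        have := ih (headI_mem (blocks_ne_nil n l))
        simp only [List.length_cons, hcc]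
        omega
      | tail _ h1 =>
        have := ih (List.mem_of_mem_tail h1)
        simp only [List.length_cons, hcc]
        omega

/-- The generalized stack-sorting map `fast` (the convention in which a letter may
sit on top of a copy of itself in the stack): `fast ε = ε`, and if
`w = A₁ n A₂ n ⋯ n A_{k+1}` where `n` is the largest letter of `w` (occurring
`k` times) and the `Aᵢ` contain only letters smaller than `n`, then
`fast w = fast A₁ ++ fast A₂ ++ ⋯ ++ fast A_{k+1} ++ n ⋯ n` (with `k` copies of `n`). -/
def fast (w : List ℕ) : List ℕ :=
  if h : w = [] then []
  else
    ((blocks (w.foldr max 0) w).attach.map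
      fun (A : {x // x ∈ blocks (w.foldr max 0) w}) =>
      have : A.1.length < w.length := by
        have h1 := blocks_length A.2
        have h2 : 0 < w.count (w.foldr max 0) :=
          List.count_pos_iff.mpr (foldr_max_mem h)
        omega
      fast A.1).flatten ++ List.replicate (w.count (w.foldr max 0)) (w.foldr max 0)
termination_by w.length

/-- The generalized stack-sorting map `slow` (the convention in which a letter may
not sit on top of a copy of itself in the stack): `slow ε = ε`, and if
`w = A₁ n A₂ n ⋯ n A_{k+1}` where `n` is the largest letter of `w` (occurring
`k` times) and the `Aᵢ` contain only letters smaller than `n`, then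
`slow w = slow A₁ ++ slow A₂ ++ [n] ++ slow A₃ ++ [n] ++ ⋯ ++ slow A_{k+1} ++ [n]`. -/
def slow (w : List ℕ) : List ℕ :=
  if h : w = [] then []
  else
    (have : (blocks (w.foldr max 0) w).headI.length < w.length := by
      have h1 := blocks_length (headI_mem (blocks_ne_nil (w.foldr max 0) w))
      have h2 : 0 < w.count (w.foldr max 0) :=
        List.count_pos_iff.mpr (foldr_max_mem h)
      omega
     slow (blocks (w.foldr max 0) w).headI) ++
    ((blocks (w.foldr max 0) w).tail.attach.map
      fun (A : {x // x ∈ (blocks (w.foldr max 0) w).tail}) =>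
      have : A.1.length < w.length := by
        have h1 := blocks_length (List.mem_of_mem_tail A.2)
        have h2 : 0 < w.count (w.foldr max 0) :=
          List.count_pos_iff.mpr (foldr_max_mem h)
        omega
      slow A.1 ++ [w.foldr max 0]).flatten
termination_by w.length

/-- Membership in `W_c`: `w` is a word over the positive integers with exactly
`cᵢ` copies of the letter `i` for each `1 ≤ i ≤ n = c.length` (and no other letters). -/
def InW (c : List ℕ) (w : List ℕ) : Prop :=
  0 ∉ w ∧ ∀ i : ℕ, w.count (i + 1) = c.getD i 0

/-- The identity word `Id_c = 1^{c₁} 2^{c₂} ⋯ n^{c_n}`, the unique word in `W_c`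
whose letters are nondecreasing from left to right. -/
def idWord (c : List ℕ) : List ℕ :=
  ((List.range c.length).map fun i => List.replicate (c.getD i 0) (i + 1)).flatten

/-- The word `η_n = 3 5 7 ⋯ (2n-3) (2n) (2n) 2 4 6 ⋯ (2n-2) (2n-1) 1`. -/
def etaWord (n : ℕ) : List ℕ :=
  ((List.range (n - 2)).map fun i => 2 * i + 3) ++ [2 * n, 2 * n] ++
    ((List.range (n - 1)).map fun i => 2 * i + 2) ++ [2 * n - 1, 1]

/-- The content vector of `η_n`: each of the letters `1, …, 2n - 1` appears once and
the letter `2n` appears twice, so `η_n ∈ W_c` for `c = (1, 1, …, 1, 2)`. -/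
def etaContent (n : ℕ) : List ℕ := List.replicate (2 * n - 1) 1 ++ [2]

lemma blocks_eq_singleton {m : ℕ} {w : List ℕ} (h : m ∉ w) : blocks m w = [w] := by
  induction w with
  | nil => rfl
  | cons a l ih =>
    simp only [List.mem_cons, not_or] at h
    simp [blocks, ih h.2, Ne.symm h.1]

lemma blocks_append_cons {m : ℕ} {A : List ℕ} (B : List ℕ) (h : m ∉ A) :
    blocks m (A ++ m :: B) = A :: blocks m B := by
  induction A with
  | nil => simp [blocks]
  | cons a l ih =>
    simp only [List.mem_cons, not_or] at h
    simp [blocks, ih h.2, Ne.symm h.1]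

lemma foldr_max_eq {m : ℕ} {w : List ℕ} (hm : m ∈ w) (h : ∀ x ∈ w, x ≤ m) :
    w.foldr max 0 = m := by
  apply le_antisymm (h _ (foldr_max_mem (List.ne_nil_of_mem hm)))
  clear h
  induction w with
  | nil => simp at hm
  | cons a l ih =>
    rcases List.mem_cons.1 hm with rfl | hm
    · simp
    · simp [ih hm]

lemma fast_nil : fast [] = [] := by
  rw [fast]
  simp

lemma slow_nil : slow [] = [] := by
  rw [slow]
  simp

lemma fast_eq {m : ℕ} {w : List ℕ} (hm : m ∈ w) (h : ∀ x ∈ w, x ≤ m) :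
    fast w = ((blocks m w).map fast).flatten ++ List.replicate (w.count m) m := by
  rw [fast, dif_neg (List.ne_nil_of_mem hm)]
  rw [List.attach_map_val (f := fast), foldr_max_eq hm h]

lemma slow_eq {m : ℕ} {w : List ℕ} (hm : m ∈ w) (h : ∀ x ∈ w, x ≤ m) :
    slow w = slow (blocks m w).headI ++
      ((blocks m w).tail.map fun A => slow A ++ [m]).flatten := by
  rw [slow, dif_neg (List.ne_nil_of_mem hm)]
  rw [List.attach_map_val (f := fun A => slow A ++ [w.foldr max 0])]
  simp only [foldr_max_eq hm h]

lemma slow_append_cons_append_cons {m : ℕ} {A B C : List ℕ} (hA : ∀ x ∈ A, x < m)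
    (hB : ∀ x ∈ B, x < m) (hC : ∀ x ∈ C, x < m) :
    slow (A ++ m :: (B ++ m :: C)) = slow A ++ (slow B ++ m :: (slow C ++ [m])) := by
  have hA' : m ∉ A := fun h => (hA m h).false
  have hB' : m ∉ B := fun h => (hB m h).false
  have hC' : m ∉ C := fun h => (hC m h).false
  rw [slow_eq (m := m) (by simp) (by grind), blocks_append_cons _ hA', blocks_append_cons _ hB',
    blocks_eq_singleton hC']
  simp

lemma fast_append_cons_append_cons {m : ℕ} {A B C : List ℕ} (hA : ∀ x ∈ A, x < m)
    (hB : ∀ x ∈ B, x < m) (hC : ∀ x ∈ C, x < m) :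
    fast (A ++ m :: (B ++ m :: C)) = fast A ++ (fast B ++ (fast C ++ [m, m])) := by
  have hA' : m ∉ A := fun h => (hA m h).false
  have hB' : m ∉ B := fun h => (hB m h).false
  have hC' : m ∉ C := fun h => (hC m h).false
  rw [fast_eq (m := m) (by simp) (by grind), blocks_append_cons _ hA', blocks_append_cons _ hB',
    blocks_eq_singleton hC']
  simp [List.count_eq_zero_of_not_mem, hA', hB', hC', List.replicate_succ]

/-- The properties shared by `fast` and `slow`: their values on words whose largest letter occurs
only once, and on words ending in the only two copies of their largest letter. -/
structure IsStackSort (f : List ℕ → List ℕ) : Prop where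
  nil : f [] = []
  append_cons : ∀ {m : ℕ} {A B : List ℕ}, (∀ x ∈ A, x < m) → (∀ x ∈ B, x < m) →
    f (A ++ m :: B) = f A ++ (f B ++ [m])
  append_pair : ∀ {m : ℕ} {A : List ℕ}, (∀ x ∈ A, x < m) → f (A ++ [m, m]) = f A ++ [m, m]

lemma isStackSort_fast : IsStackSort fast where
  nil := fast_nil
  append_cons {m A B} hA hB := by
    have hA' : m ∉ A := fun h => (hA m h).false
    have hB' : m ∉ B := fun h => (hB m h).false
    rw [fast_eq (m := m) (by simp) (by grind), blocks_append_cons _ hA', blocks_eq_singleton hB']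
    simp [List.count_eq_zero_of_not_mem, hA', hB']
  append_pair {m A} hA := by
    simpa [fast_nil] using fast_append_cons_append_cons (B := []) (C := []) hA (by simp) (by simp)

lemma isStackSort_slow : IsStackSort slow where
  nil := slow_nil
  append_cons {m A B} hA hB := by
    have hA' : m ∉ A := fun h => (hA m h).false
    have hB' : m ∉ B := fun h => (hB m h).false
    rw [slow_eq (m := m) (by simp) (by grind), blocks_append_cons _ hA', blocks_eq_singleton hB']
    simp
  append_pair {m A} hA := by
    simpa [slow_nil] using slow_append_cons_append_cons (B := []) (C := []) hA (by simp) (by simp)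

/-- The word `3 5 7 ⋯ (2p+1)`. -/
def oddWord (p : ℕ) : List ℕ := (List.range p).map fun i => 2 * i + 3

/-- The word `2 4 6 ⋯ (2p)`. -/
def evenWord (p : ℕ) : List ℕ := (List.range p).map fun i => 2 * i + 2

lemma oddWord_succ (p : ℕ) : oddWord (p + 1) = oddWord p ++ [2 * p + 3] := by
  simp [oddWord, List.range_succ]

lemma evenWord_succ (p : ℕ) : evenWord (p + 1) = evenWord p ++ [2 * p + 2] := by
  simp [evenWord, List.range_succ]

lemma lt_of_mem_oddWord {p x : ℕ} (h : x ∈ oddWord p) : x < 2 * p + 2 := by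
  simp only [oddWord, List.mem_map, List.mem_range] at h
  omega

lemma lt_of_mem_evenWord {p x : ℕ} (h : x ∈ evenWord p) : x < 2 * p + 1 := by
  simp only [evenWord, List.mem_map, List.mem_range] at h
  omega

namespace IsStackSort

variable {f : List ℕ → List ℕ}

lemma append_singleton (hf : IsStackSort f) {m : ℕ} {A : List ℕ} (hA : ∀ x ∈ A, x < m) :
    f (A ++ [m]) = f A ++ [m] := by
  rw [hf.append_cons hA (by simp), hf.nil, List.nil_append]

lemma append_range' (hf : IsStackSort f) {a : ℕ} {A : List ℕ} (k : ℕ) (hA : ∀ x ∈ A, x < a) :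
    f (A ++ List.range' a k) = f A ++ List.range' a k := by
  induction k with
  | zero => simp
  | succ k ih =>
    rw [List.range'_concat, ← List.append_assoc, hf.append_singleton, ih, List.append_assoc]
    intro x hx
    simp only [List.mem_append, List.mem_range'_1] at hx
    rcases hx with hx | hx
    · have := hA x hx
      omega
    · omega

lemma append_range'_pair (hf : IsStackSort f) {a k m : ℕ} {A : List ℕ} (hA : ∀ x ∈ A, x < a)
    (h : a + k ≤ m) :
    f (A ++ (List.range' a k ++ [m, m])) = f A ++ (List.range' a k ++ [m, m]) := by
  rw [← List.append_assoc, hf.append_pair, hf.append_range' k hA, List.append_assoc]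
  intro x hx
  simp only [List.mem_append, List.mem_range'_1] at hx
  rcases hx with hx | hx
  · have := hA x hx
    omega
  · omega

lemma singleton (hf : IsStackSort f) (m : ℕ) : f [m] = [m] := by
  simpa [hf.nil] using hf.append_singleton (m := m) (A := []) (by simp)

lemma oddWord_eq (hf : IsStackSort f) (p : ℕ) : f (oddWord p) = oddWord p := by
  induction p with
  | zero => exact hf.nil
  | succ p ih =>
    rw [oddWord_succ, hf.append_singleton, ih]
    intro x hx
    have := lt_of_mem_oddWord hx
    omega

lemma evenWord_eq (hf : IsStackSort f) (p : ℕ) : f (evenWord p) = evenWord p := by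
  induction p with
  | zero => exact hf.nil
  | succ p ih =>
    rw [evenWord_succ, hf.append_singleton, ih]
    intro x hx
    have := lt_of_mem_evenWord hx
    omega

end IsStackSort

/-- If `u` is a fixed point of `g` reached from `w` for the first time after `k + 1` steps,
then `k + 1` is the least number of steps. -/
lemma sInf_iterate_eq {α : Type*} {g : α → α} {u w : α} {k : ℕ} (hu : g u = u)
    (h : g^[k] w ≠ u) (h' : g^[k + 1] w = u) : sInf {j | g^[j] w = u} = k + 1 := by
  refine le_antisymm (Nat.sInf_le h') (le_csInf ⟨_, h'⟩ fun j hj => ?_)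
  by_contra! hlt
  apply h
  obtain ⟨d, rfl⟩ := Nat.exists_eq_add_of_le (Nat.lt_succ_iff.1 hlt)
  replace hj : g^[j] w = u := hj
  rw [Nat.add_comm, Function.iterate_add_apply, hj]
  exact Function.iterate_fixed hu d

lemma etaWord_eq (p : ℕ) : etaWord (p + 2) =
    oddWord p ++ (2 * p + 4) :: ([] ++ (2 * p + 4) :: (evenWord (p + 1) ++ [2 * p + 3, 1])) := by
  simp [etaWord, oddWord, evenWord, Nat.mul_add]

lemma idWord_etaContent (n : ℕ) :
    idWord (etaContent (n + 1)) = List.range' 1 (2 * n + 1) ++ [2 * n + 2, 2 * n + 2] := by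
  have hc : etaContent (n + 1) = List.replicate (2 * n + 1) 1 ++ [2] := rfl
  have h : (List.range (2 * n + 1)).map
      (fun i => List.replicate ((etaContent (n + 1)).getD i 0) (i + 1)) =
      (List.range (2 * n + 1)).map fun i => [i + 1] := by
    refine List.map_congr_left fun i hi => ?_
    have hi := List.mem_range.1 hi
    rw [hc, List.getD_append _ _ _ _ (by simpa using hi), List.getD_replicate _ hi,
      List.replicate_one]
  have hlen : (etaContent (n + 1)).length = 2 * n + 1 + 1 := by
    simp [hc]
  have hlast : (etaContent (n + 1)).getD (2 * n + 1) 0 = 2 := by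
    rw [hc, List.getD_append_right _ _ _ _ (by simp)]
    simp
  rw [idWord, hlen, List.range_succ, List.map_append, h, List.map_singleton, hlast,
    List.flatten_append, List.flatten_singleton, ← List.flatMap_def, ← List.map_eq_flatMap,
    List.range'_eq_map_range]
  simp [List.replicate_succ, Nat.add_comm]
  omega

/-- The words reached from `etaWord` under iteration of `fast`. -/
def fastState (p q k m : ℕ) : List ℕ :=
  (oddWord p ++ (evenWord p ++ (List.range' (2 * p + 2) (q + 1) ++ [1]))) ++
    (List.range' (2 * p + q + 3) k ++ [m, m])

/-- The words reached from `etaWord` under iteration of `slow`. -/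
def slowState (p k m : ℕ) : List ℕ :=
  (oddWord p ++ (evenWord p ++ [1])) ++ (List.range' (2 * p + 2) k ++ [m, m])

lemma fast_fastState_succ {p q k m : ℕ} (h : 2 * p + q + k + 5 ≤ m) :
    fast (fastState (p + 1) q k m) = fastState p (q + 1) (k + 1) m := by
  have hf := isStackSort_fast
  have hodd : ∀ x ∈ oddWord p, x < 2 * p + 3 := fun x hx => (lt_of_mem_oddWord hx).trans (by omega)
  have heven : ∀ x ∈ evenWord (p + 1), x < 2 * p + 3 := fun x hx => lt_of_mem_evenWord hx
  have h1 : ∀ x ∈ oddWord p ++ (2 * p + 3) :: evenWord (p + 1), x < 2 * p + 4 := by grind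
  have h2 : ∀ x ∈ (oddWord p ++ (2 * p + 3) :: evenWord (p + 1)) ++ List.range' (2 * p + 4) q,
      x < 2 * p + 4 + q := by
    simp only [List.mem_append (s := oddWord p ++ _), List.mem_range'_1]
    rintro x (hx | hx)
    · have := h1 x hx
      omega
    · omega
  have h3 : ∀ x ∈ ((oddWord p ++ (2 * p + 3) :: evenWord (p + 1)) ++ List.range' (2 * p + 4) q) ++
      (2 * p + 4 + q) :: [1], x < 2 * p + 5 + q := by
    intro x hx
    rcases List.mem_append.1 hx with hx | hx
    · have := h2 x hx
      omega
    · simp at hx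
      omega
  have e : fastState (p + 1) q k m =
      (((oddWord p ++ (2 * p + 3) :: evenWord (p + 1)) ++ List.range' (2 * p + 4) q) ++
        (2 * p + 4 + q) :: [1]) ++ (List.range' (2 * p + 5 + q) k ++ [m, m]) := by
    rw [fastState, oddWord_succ, List.range'_concat]
    simp [Nat.mul_add, Nat.add_right_comm]
  rw [e, hf.append_range'_pair h3 (by omega), hf.append_cons h2 (by simp; omega), hf.append_range' q h1,
    hf.append_cons hodd heven, hf.oddWord_eq, hf.evenWord_eq, hf.singleton, fastState,
    evenWord_succ, List.range'_succ, List.range'_succ (n := q), List.range'_succ (n := k)]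
  simp
  grind

lemma fast_fastState_zero_succ {q k m : ℕ} (h : q + k + 4 ≤ m) :
    fast (fastState 0 (q + 1) k m) = fastState 0 q (k + 1) m := by
  have hf := isStackSort_fast
  have h1 : ∀ x ∈ List.range' 2 (q + 1), x < q + 3 := by
    intro x hx
    rw [List.mem_range'_1] at hx
    omega
  have h2 : ∀ x ∈ List.range' 2 (q + 1) ++ (q + 3) :: [1], x < q + 4 := by grind
  have e : fastState 0 (q + 1) k m =
      (List.range' 2 (q + 1) ++ (q + 3) :: [1]) ++ (List.range' (q + 4) k ++ [m, m]) := by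
    rw [fastState, List.range'_concat]
    simp [oddWord, evenWord, Nat.add_comm]
  have h3 := hf.append_range' (a := 2) (A := []) (q + 1) (by simp)
  rw [List.nil_append, hf.nil, List.nil_append] at h3
  rw [e, hf.append_range'_pair h2 (by omega), hf.append_cons h1 (by simp), h3, hf.singleton,
    fastState, List.range'_succ (n := k)]
  simp [oddWord, evenWord]

lemma fastState_zero_zero (k m : ℕ) :
    fastState 0 0 k m = [2, 1] ++ (List.range' 3 k ++ [m, m]) := by
  simp [fastState, oddWord, evenWord]

lemma fast_fastState_zero_zero {k m : ℕ} (h : k + 3 ≤ m) :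
    fast (fastState 0 0 k m) = List.range' 1 (k + 2) ++ [m, m] := by
  have hf := isStackSort_fast
  have h1 : fast [2, 1] = [1, 2] := by
    simpa [hf.nil, hf.singleton] using hf.append_cons (m := 2) (A := []) (B := [1])
  rw [fastState_zero_zero, hf.append_range'_pair (by simp) (by omega), h1]
  simp [List.range'_succ]

lemma iterate_fast_fastState {p q k m : ℕ} (i : ℕ) (h : 2 * (p + i) + q + k + 3 ≤ m) :
    fast^[i] (fastState (p + i) q k m) = fastState p (q + i) (k + i) m := by
  induction i generalizing q k with
  | zero => rfl
  | succ i ih =>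
    rw [Function.iterate_succ_apply, ← Nat.add_assoc, fast_fastState_succ (by omega),
      ih (by omega)]
    simp [Nat.add_comm, Nat.add_left_comm]

lemma iterate_fast_fastState_zero {q k m : ℕ} (i : ℕ) (h : q + i + k + 3 ≤ m) :
    fast^[i] (fastState 0 (q + i) k m) = fastState 0 q (k + i) m := by
  induction i generalizing k with
  | zero => rfl
  | succ i ih =>
    rw [Function.iterate_succ_apply, ← Nat.add_assoc, fast_fastState_zero_succ (by omega),
      ih (by omega)]
    simp [Nat.add_comm, Nat.add_left_comm]

lemma fast_etaWord (p : ℕ) : fast (etaWord (p + 2)) = fastState p 0 1 (2 * p + 4) := by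
  have hf := isStackSort_fast
  have h1 : ∀ x ∈ oddWord p, x < 2 * p + 4 := fun x hx => (lt_of_mem_oddWord hx).trans (by omega)
  have h2 : ∀ x ∈ evenWord (p + 1), x < 2 * p + 3 := fun x hx => lt_of_mem_evenWord hx
  have h3 : ∀ x ∈ evenWord (p + 1) ++ [2 * p + 3, 1], x < 2 * p + 4 := by grind
  rw [etaWord_eq, fast_append_cons_append_cons h1 (by simp) h3, hf.append_cons h2 (by simp),
    hf.nil, hf.oddWord_eq, hf.evenWord_eq, hf.singleton, fastState, evenWord_succ]
  simp

lemma slow_slowState_succ {p k m : ℕ} (h : 2 * p + k + 4 ≤ m) :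
    slow (slowState (p + 1) k m) = slowState p (k + 2) m := by
  have hf := isStackSort_slow
  have hodd : ∀ x ∈ oddWord p, x < 2 * p + 3 := fun x hx => (lt_of_mem_oddWord hx).trans (by omega)
  have heven : ∀ x ∈ evenWord p, x < 2 * p + 2 :=
    fun x hx => (lt_of_mem_evenWord hx).trans (by omega)
  have h1 : ∀ x ∈ evenWord p ++ (2 * p + 2) :: [1], x < 2 * p + 3 := by grind
  have h2 : ∀ x ∈ oddWord p ++ (2 * p + 3) :: (evenWord p ++ (2 * p + 2) :: [1]),
      x < 2 * p + 4 := by grind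
  have e : slowState (p + 1) k m = (oddWord p ++ (2 * p + 3) :: (evenWord p ++ (2 * p + 2) :: [1]))
      ++ (List.range' (2 * p + 4) k ++ [m, m]) := by
    rw [slowState, oddWord_succ, evenWord_succ]
    simp [Nat.mul_add]
  rw [e, hf.append_range'_pair h2 (by omega), hf.append_cons hodd h1,
    hf.append_cons heven (by simp), hf.oddWord_eq, hf.evenWord_eq, hf.singleton, slowState,
    List.range'_succ, List.range'_succ]
  simp

lemma iterate_slow_slowState {p k m : ℕ} (i : ℕ) (h : 2 * (p + i) + k + 2 ≤ m) :
    slow^[i] (slowState (p + i) k m) = slowState p (k + 2 * i) m := by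
  induction i generalizing k with
  | zero => rfl
  | succ i ih =>
    rw [Function.iterate_succ_apply, ← Nat.add_assoc, slow_slowState_succ (by omega),
      ih (by omega)]
    congr 1
    omega

lemma slowState_zero (k m : ℕ) : slowState 0 k m = List.range' 1 (k + 1) ++ [m, m] := by
  simp [slowState, oddWord, evenWord, List.range'_succ]

lemma slow_slow_etaWord (p : ℕ) :
    slow (slow (etaWord (p + 2))) = slowState p 2 (2 * p + 4) := by
  have hf := isStackSort_slow
  have hodd : ∀ x ∈ oddWord p, x < 2 * p + 4 := fun x hx => (lt_of_mem_oddWord hx).trans (by omega)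
  have heven : ∀ x ∈ evenWord p, x < 2 * p + 2 :=
    fun x hx => (lt_of_mem_evenWord hx).trans (by omega)
  have heven' : ∀ x ∈ evenWord (p + 1), x < 2 * p + 3 := fun x hx => lt_of_mem_evenWord hx
  have h1 : ∀ x ∈ evenWord (p + 1) ++ [2 * p + 3, 1], x < 2 * p + 4 := by grind
  have h2 : ∀ x ∈ evenWord p ++ (2 * p + 2) :: [1], x < 2 * p + 3 := by grind
  have h3 : ∀ x ∈ (evenWord p ++ (2 * p + 2) :: [1]) ++ [2 * p + 3], x < 2 * p + 4 := by grind
  have e : slow (etaWord (p + 2)) = oddWord p ++ (2 * p + 4) ::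
      (((evenWord p ++ (2 * p + 2) :: [1]) ++ [2 * p + 3]) ++ (2 * p + 4) :: []) := by
    rw [etaWord_eq, slow_append_cons_append_cons hodd (by simp) h1, hf.append_cons heven' (by simp),
      hf.nil, hf.oddWord_eq, hf.evenWord_eq, hf.singleton, evenWord_succ]
    simp
  rw [e, slow_append_cons_append_cons hodd h3 (by simp), hf.append_singleton h2,
    hf.append_cons heven (by simp), hf.nil, hf.oddWord_eq, hf.evenWord_eq, hf.singleton, slowState]
  simp [List.range'_succ]

lemma IsStackSort.idWord_etaContent_eq {f : List ℕ → List ℕ} (hf : IsStackSort f) (n : ℕ) :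
    f (idWord (etaContent (n + 1))) = idWord (etaContent (n + 1)) := by
  rw [idWord_etaContent]
  simpa [hf.nil] using
    hf.append_range'_pair (a := 1) (k := 2 * n + 1) (m := 2 * n + 2) (A := []) (by simp) (by omega)

lemma iterate_fast_etaWord (p : ℕ) :
    fast^[2 * p + 1] (etaWord (p + 2)) = fastState 0 0 (2 * p + 1) (2 * p + 4) := by
  have h1 := iterate_fast_fastState (p := 0) (q := 0) (k := 1) (m := 2 * p + 4) p (by omega)
  have h2 := iterate_fast_fastState_zero (q := 0) (k := 1 + p) (m := 2 * p + 4) p (by omega)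
  rw [Nat.zero_add] at h1 h2
  rw [Function.iterate_succ_apply, fast_etaWord, Nat.two_mul, Function.iterate_add_apply,
    ← Nat.two_mul, h1, h2]
  congr 1
  omega

lemma iterate_slow_etaWord {p i r : ℕ} (h : p = r + i) :
    slow^[i + 2] (etaWord (p + 2)) = slowState r (2 + 2 * i) (2 * p + 4) := by
  rw [Function.iterate_succ_apply, Function.iterate_succ_apply, slow_slow_etaWord]
  subst h
  exact iterate_slow_slowState i (by omega)

/-- For any integer `n ≥ 3`, the word `η_n = 3 5 7 ⋯ (2n-3) (2n) (2n) 2 4 6 ⋯ (2n-2) (2n-1) 1`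
has length `2n + 1` and satisfies `⟨η_n⟩_fast = 2n - 2` and `⟨η_n⟩_slow = n`. -/
theorem eta_dist (n : ℕ) (hn : 3 ≤ n) :
    (etaWord n).length = 2 * n + 1 ∧
    (∃ k, fast^[k] (etaWord n) = idWord (etaContent n)) ∧
    sInf {k | fast^[k] (etaWord n) = idWord (etaContent n)} = 2 * n - 2 ∧
    (∃ k, slow^[k] (etaWord n) = idWord (etaContent n)) ∧
    sInf {k | slow^[k] (etaWord n) = idWord (etaContent n)} = n := by
  obtain ⟨r, rfl⟩ := Nat.exists_eq_add_of_le' hn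
  have hid : idWord (etaContent (r + 3)) =
      List.range' 1 (2 * r + 5) ++ [2 * (r + 1) + 4, 2 * (r + 1) + 4] :=
    idWord_etaContent (r + 2)
  have hfast : fast^[2 * (r + 1) + 1 + 1] (etaWord (r + 3)) = idWord (etaContent (r + 3)) := by
    rw [Function.iterate_succ_apply', iterate_fast_etaWord (r + 1),
      fast_fastState_zero_zero (by omega), hid, Nat.mul_succ]
  have hfast' : fast^[2 * (r + 1) + 1] (etaWord (r + 3)) ≠ idWord (etaContent (r + 3)) := by
    rw [iterate_fast_etaWord (r + 1), fastState_zero_zero, hid]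
    simp [List.range'_succ]
  have hslow : slow^[r + 2 + 1] (etaWord (r + 3)) = idWord (etaContent (r + 3)) := by
    rw [iterate_slow_etaWord (p := r + 1) (i := r + 1) (r := 0) (by omega), slowState_zero, hid]
    congr 2
    omega
  have hslow' : slow^[r + 2] (etaWord (r + 3)) ≠ idWord (etaContent (r + 3)) := by
    rw [iterate_slow_etaWord (p := r + 1) (i := r) (r := 1) (by omega), hid]
    simp [slowState, oddWord, List.range'_succ]
  refine ⟨?_, ⟨_, hfast⟩, ?_, ⟨_, hslow⟩, ?_⟩
  · simp [etaWord]
    omega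
  · rw [sInf_iterate_eq (isStackSort_fast.idWord_etaContent_eq (r + 2)) hfast' hfast]
    omega
  · exact sInf_iterate_eq (isStackSort_slow.idWord_etaContent_eq (r + 2)) hslow' hslow
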